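/- arXiv:2204.11267 — 4 statements merged into one kernel-verified Lean document; each statement's English description precedes it below -/
import Mathlib

section
/- For every odd prime p, there exists a real number x with 1 − 1/√p < x < 1 such that Φ_{2p}'(x) = 0, i.e., the derivative of the (2p)-th cyclotomic polynomial has a real root in the open interval (1 − 1/√p, 1). -/
open Polynomial

theorem cubic_le_one_add_pow {t : ℝ} (ht : 0 ≤ t) (n : ℕ) :
    1 + n * t + n * (n - 1) / 2 * t ^ 2 + n * (n - 1) * (n - 2) / 6 * t ^ 3 ≤ (1 + t) ^ n := by
  induction n with
  | zero => simp
  | succ n ih =>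
    have hn : (0 : ℝ) ≤ n * (n - 1) * (n - 2) := by
      rcases n with _ | _ | n
      · simp
      · simp
      · push_cast
        ring_nf
        positivity
    have h4 : 0 ≤ n * (n - 1) * (n - 2) / 6 * t ^ 4 := by positivity
    have hmul := mul_le_mul_of_nonneg_right ih (by linarith : 0 ≤ 1 + t)
    rw [pow_succ (1 + t)]
    push_cast
    linarith

theorem one_sub_inv_pow_mul_lt_one {s : ℝ} (hs : 1 < s) {n : ℕ} (hn : (n : ℝ) = s ^ 2 - 1) :
    (1 - 1 / s) ^ n * ((s ^ 2 - 1) * (1 - 1 / s) + s ^ 2) < 1 := by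
  obtain ⟨r, rfl⟩ : ∃ r, s = 1 + r := ⟨s - 1, by ring⟩
  have hr : 0 < r := by linarith
  have hbase : 1 - 1 / (1 + r) = (1 + 1 / r)⁻¹ := by
    field_simp
    ring
  have hcubic := cubic_le_one_add_pow (one_div_pos.mpr hr).le n
  rw [hn] at hcubic
  have hle : ((1 + r) ^ 2 - 1) * (1 - 1 / (1 + r)) + (1 + r) ^ 2 ≤ 2 * r ^ 2 + 3 * r + 1 := by
    have hinv : 1 / (1 + r) ≤ 1 := by
      rw [div_le_one (by linarith)]
      linarith
    have heq : ((1 + r) ^ 2 - 1) * (1 - 1 / (1 + r)) + (1 + r) ^ 2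
        = 2 * r ^ 2 + 3 * r + 1 / (1 + r) := by
      field_simp
      ring
    linarith
  have hlt : 2 * r ^ 2 + 3 * r + 1 < (1 + 1 / r) ^ n := by
    refine lt_of_lt_of_le ?_ hcubic
    rw [← sub_pos]
    have heq : 1 + ((1 + r) ^ 2 - 1) * (1 / r)
        + ((1 + r) ^ 2 - 1) * ((1 + r) ^ 2 - 1 - 1) / 2 * (1 / r) ^ 2
        + ((1 + r) ^ 2 - 1) * ((1 + r) ^ 2 - 1 - 1) * ((1 + r) ^ 2 - 1 - 2) / 6 * (1 / r) ^ 3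
        - (2 * r ^ 2 + 3 * r + 1)
        = (r ^ 3 * (r ^ 2 - 3 * r + 9) + (17 * r ^ 2 - 16 * r + 4)) / (6 * r ^ 2) := by
      field_simp
      ring
    rw [heq]
    have h₁ : 0 < r ^ 2 - 3 * r + 9 := by nlinarith [sq_nonneg (r - 3 / 2)]
    have h₂ : 0 < 17 * r ^ 2 - 16 * r + 4 := by nlinarith [sq_nonneg (r - 8 / 17)]
    positivity
  rw [hbase, inv_pow, ← hbase, inv_mul_lt_one₀ (by positivity)]
  exact hle.trans_lt hlt

theorem cyclotomic_two_mul_prime_mul_X_add_one (R : Type*) [CommRing R] {p : ℕ} (hp : p.Prime)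
    (hodd : Odd p) : cyclotomic (2 * p) R * (X + 1) = X ^ p + 1 := by
  have hcomp : cyclotomic (2 * p) ℤ * (X + 1) = X ^ p + 1 := by
    have hp2 : ¬ p ∣ 2 := fun h => by
      have := (Nat.prime_dvd_prime_iff_eq hp Nat.prime_two).mp h
      subst this
      exact absurd hodd (by decide)
    have hexp : expand ℤ p (cyclotomic 2 ℤ) = cyclotomic (2 * p) ℤ * cyclotomic 2 ℤ :=
      cyclotomic_expand_eq_cyclotomic_mul hp hp2 ℤ
    simpa [cyclotomic_two] using hexp.symm
  simpa using congrArg (Polynomial.map (Int.castRingHom R)) hcomp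

theorem eval_derivative_cyclotomic_two_mul_prime {p : ℕ} (hp : p.Prime) (hodd : Odd p) (x : ℝ) :
    (derivative (cyclotomic (2 * p) ℝ)).eval x * (x + 1) ^ 2
      = x ^ (p - 1) * ((p - 1) * x + p) - 1 := by
  have h := cyclotomic_two_mul_prime_mul_X_add_one ℝ hp hodd
  have h₀ := congrArg (eval x) h
  have h₁ := congrArg (fun q => eval x (derivative q)) h
  simp only [derivative_mul, derivative_add, derivative_X, derivative_one, derivative_X_pow,
    eval_add, eval_mul, eval_X, eval_one, eval_pow, eval_C, eval_zero] at h₀ h₁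
  have hpow : x ^ p = x ^ (p - 1) * x := (pow_sub_one_mul hp.ne_zero x).symm
  rw [hpow] at h₀
  linear_combination (x + 1) * h₁ - h₀

theorem cyclotomic_two_mul_prime_deriv_has_root (p : ℕ) (hp : p.Prime) (hodd : Odd p) :
    ∃ x : ℝ, 1 - 1 / Real.sqrt p < x ∧ x < 1 ∧
      (Polynomial.derivative (Polynomial.cyclotomic (2 * p) ℝ)).eval x = 0 := by
  have hp1 : (1 : ℝ) < p := by exact_mod_cast hp.one_lt
  have hs : 1 < Real.sqrt p := Real.lt_sqrt_of_sq_lt (by simpa using hp1)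
  have hsq : Real.sqrt p ^ 2 = p := Real.sq_sqrt p.cast_nonneg
  have hlt := one_sub_inv_pow_mul_lt_one hs (n := p - 1)
    (by rw [hsq, Nat.cast_pred hp.pos])
  rw [hsq] at hlt
  set a := 1 - 1 / Real.sqrt p
  have ha1 : a < 1 := sub_lt_self _ (by positivity)
  have ha0 : 0 < a := sub_pos.mpr ((div_lt_one (by linarith)).mpr hs)
  have hneg : (derivative (cyclotomic (2 * p) ℝ)).eval a < 0 := by
    have h := eval_derivative_cyclotomic_two_mul_prime hp hodd a
    have : 0 < (a + 1) ^ 2 := by positivity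
    by_contra! hc
    nlinarith [mul_nonneg hc this.le]
  have hpos : 0 < (derivative (cyclotomic (2 * p) ℝ)).eval 1 := by
    have h := eval_derivative_cyclotomic_two_mul_prime hp hodd 1
    rw [one_pow] at h
    linarith
  obtain ⟨x, ⟨hax, hx1⟩, hx⟩ := intermediate_value_Ioo ha1.le
    (derivative (cyclotomic (2 * p) ℝ)).continuous.continuousOn ⟨hneg, hpos⟩
  exact ⟨x, hax, hx1, hx⟩
end

section
/- For every integer n ≥ 2, one has the integer identity 96·Φ_n^{(5)}(1) = Φ_n(1)·(φ(n) − 4)·( 3·φ(n)⁴ − 48·φ(n)³ + 10·J_2(n)·φ(n)² + 228·φ(n)² − 80·J_2(n)·φ(n) − 288·φ(n) + 5·J_2(n)² + 100·J_2(n) − 2·J_4(n) ). -/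
open Polynomial Finset

/-- Jordan totient function `J_k(n) = Σ_{d ∣ n} μ(n/d)·d^k`. -/
def jordanTotient (k n : ℕ) : ℤ :=
  ∑ d ∈ n.divisors, (ArithmeticFunction.moebius (n / d) : ℤ) * (d : ℤ) ^ k

namespace PowerSeries

variable {K : Type*} [Field K]

/-- The logarithmic derivative `f' / f` of a power series over a field. -/
noncomputable def logDerivative (f : K⟦X⟧) : K⟦X⟧ :=
  derivative K f * f⁻¹

theorem logDerivative_mul_self {f : K⟦X⟧} (hf : constantCoeff f ≠ 0) :
    logDerivative f * f = derivative K f := by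
  rw [logDerivative, mul_assoc, PowerSeries.inv_mul_cancel f hf, mul_one]

theorem logDerivative_one : logDerivative (1 : K⟦X⟧) = 0 := by
  simp [logDerivative]

theorem logDerivative_mul {f g : K⟦X⟧} (hf : constantCoeff f ≠ 0) (hg : constantCoeff g ≠ 0) :
    logDerivative (f * g) = logDerivative f + logDerivative g := by
  rw [logDerivative, logDerivative, logDerivative, PowerSeries.mul_inv_rev, Derivation.leibniz]
  simp only [smul_eq_mul]
  linear_combination derivative K g * g⁻¹ * PowerSeries.mul_inv_cancel f hf +
    derivative K f * f⁻¹ * PowerSeries.mul_inv_cancel g hg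

theorem logDerivative_prod {ι : Type*} (s : Finset ι) {f : ι → K⟦X⟧}
    (hf : ∀ i ∈ s, constantCoeff (f i) ≠ 0) :
    logDerivative (∏ i ∈ s, f i) = ∑ i ∈ s, logDerivative (f i) := by
  classical
  induction s using Finset.induction_on with
  | empty => simp [logDerivative_one]
  | insert a s ha ih =>
    have hs : ∀ i ∈ s, constantCoeff (f i) ≠ 0 := fun i hi => hf i (Finset.mem_insert_of_mem hi)
    rw [Finset.prod_insert ha, Finset.sum_insert ha, logDerivative_mul (hf a (by simp)), ih hs]
    rw [map_prod]
    exact Finset.prod_ne_zero_iff.2 hs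

theorem coeff_succ_mul_eq_sum_logDerivative {f : K⟦X⟧} (hf : constantCoeff f ≠ 0) (k : ℕ) :
    coeff (k + 1) f * (k + 1) =
      ∑ i ∈ Finset.range (k + 1), coeff i (logDerivative f) * coeff (k - i) f := by
  rw [← coeff_derivative, ← logDerivative_mul_self hf, coeff_mul,
    Finset.Nat.sum_antidiagonal_eq_sum_range_succ_mk]

end PowerSeries

/-- The expansion around `1` of a rational polynomial, as a power series. -/
noncomputable def expansionAtOne (P : ℚ[X]) : PowerSeries ℚ :=
  (taylorAlgHom (1 : ℚ) P : ℚ[X])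

theorem coeff_expansionAtOne (P : ℚ[X]) (k : ℕ) :
    PowerSeries.coeff k (expansionAtOne P) = (taylor 1 P).coeff k :=
  Polynomial.coeff_coe _ _

theorem constantCoeff_expansionAtOne (P : ℚ[X]) :
    PowerSeries.constantCoeff (expansionAtOne P) = P.eval 1 := by
  simp [expansionAtOne, ← PowerSeries.coeff_zero_eq_constantCoeff_apply]

theorem expansionAtOne_prod {ι : Type*} (s : Finset ι) (P : ι → ℚ[X]) :
    expansionAtOne (∏ i ∈ s, P i) = ∏ i ∈ s, expansionAtOne (P i) := by
  simp only [expansionAtOne, map_prod]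
  exact map_prod Polynomial.coeToPowerSeries.ringHom _ _

theorem factorial_mul_coeff_expansionAtOne (P : ℚ[X]) (k : ℕ) :
    (k.factorial : ℚ) * PowerSeries.coeff k (expansionAtOne P) =
      (derivative^[k] P).eval 1 := by
  rw [coeff_expansionAtOne, taylor_coeff, ← factorial_smul_hasseDeriv]
  simp

theorem eval_one_cyclotomic_ne_zero {n : ℕ} (hn : 2 ≤ n) :
    (cyclotomic n ℚ).eval 1 ≠ 0 := by
  intro h
  have : NeZero (n : ℚ) := ⟨by positivity⟩
  have := (isRoot_cyclotomic_iff.1 h).eq_orderOf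
  simp at this
  omega

theorem coeff_expansionAtOne_geom_sum (n k : ℕ) :
    PowerSeries.coeff k (expansionAtOne (∑ i ∈ range n, (X : ℚ[X]) ^ i)) = n.choose (k + 1) := by
  rw [coeff_expansionAtOne, taylor_apply, C_1, geom_sum_X_comp_X_add_one_eq_sum, finsetSum_coeff]
  simp only [← C_eq_natCast, coeff_C_mul, coeff_X_pow, mul_ite, mul_one, mul_zero]
  simp only [sum_ite_eq, mem_range, ite_eq_left_iff, not_lt]
  intro h
  rw [Nat.choose_eq_zero_of_lt (by omega), Nat.cast_zero]

theorem cast_choose_succ_mul (n k : ℕ) :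
    (n.choose (k + 1) : ℚ) * (k + 1) = n.choose k * (n - k) := by
  rcases le_or_gt k n with h | h
  · rw [← Nat.cast_sub h]
    exact_mod_cast Nat.choose_succ_right_eq n k
  · simp [Nat.choose_eq_zero_of_lt h, Nat.choose_eq_zero_of_lt (Nat.lt_succ_of_lt h)]

/-- The coefficients up to degree four of `(a + b * t + c * t ^ 3 / 6) / (1 + X)`, where
`t = log (1 + X)`. -/
def cumulantCoeff (a b c : ℚ) : ℕ → ℚ
  | 0 => a
  | 1 => -a + b
  | 2 => a - 3 / 2 * b
  | 3 => -a + 11 / 6 * b + c / 6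
  | 4 => a - 25 / 12 * b - 5 / 12 * c
  | _ => 0

theorem coeff_logDerivative_geom_sum {n : ℕ} (hn : 0 < n) {k : ℕ} (hk : k < 5) :
    PowerSeries.coeff k
        (PowerSeries.logDerivative (expansionAtOne (∑ i ∈ range n, (X : ℚ[X]) ^ i))) =
      cumulantCoeff (((n : ℚ) - 1) / 2) (((n : ℚ) ^ 2 - 1) / 12) (-((n : ℚ) ^ 4 - 1) / 120) k := by
  set q := expansionAtOne (∑ i ∈ range n, (X : ℚ[X]) ^ i) with hq
  have hn' : (n : ℚ) ≠ 0 := by positivity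
  have hq0 : PowerSeries.constantCoeff q ≠ 0 := by
    rw [constantCoeff_expansionAtOne]
    simpa [eval_finsetSum] using hn'
  have hrec := PowerSeries.coeff_succ_mul_eq_sum_logDerivative hq0
  simp only [hq, coeff_expansionAtOne_geom_sum] at hrec
  rw [← hq] at hrec
  have c2 : (n.choose 2 : ℚ) = n * (n - 1) / 2 := by
    have := cast_choose_succ_mul n 1; norm_num at this; linarith
  have c3 : (n.choose 3 : ℚ) = n * (n - 1) * (n - 2) / 6 := by
    have := cast_choose_succ_mul n 2; norm_num [c2] at this; linarith
  have c4 : (n.choose 4 : ℚ) = n * (n - 1) * (n - 2) * (n - 3) / 24 := by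
    have := cast_choose_succ_mul n 3; norm_num [c3] at this; linarith
  have c5 : (n.choose 5 : ℚ) = n * (n - 1) * (n - 2) * (n - 3) * (n - 4) / 120 := by
    have := cast_choose_succ_mul n 4; norm_num [c4] at this; linarith
  have c6 : (n.choose 6 : ℚ) = n * (n - 1) * (n - 2) * (n - 3) * (n - 4) * (n - 5) / 720 := by
    have := cast_choose_succ_mul n 5; norm_num [c5] at this; linarith
  have h0 := hrec 0
  have h1 := hrec 1
  have h2 := hrec 2
  have h3 := hrec 3
  have h4 := hrec 4
  simp [sum_range_succ, -PowerSeries.coeff_zero_eq_constantCoeff, c2, c3, c4, c5, c6]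
    at h0 h1 h2 h3 h4
  generalize PowerSeries.logDerivative q = L at *
  have e0 : PowerSeries.coeff 0 L = ((n : ℚ) - 1) / 2 := by
    apply mul_right_cancel₀ hn'
    linear_combination -h0
  rw [e0] at h1 h2 h3 h4
  have e1 : PowerSeries.coeff 1 L = -(((n : ℚ) - 1) / 2) + ((n : ℚ) ^ 2 - 1) / 12 := by
    apply mul_right_cancel₀ hn'
    linear_combination -h1
  rw [e1] at h2 h3 h4
  have e2 : PowerSeries.coeff 2 L = ((n : ℚ) - 1) / 2 - 3 / 2 * (((n : ℚ) ^ 2 - 1) / 12) := by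
    apply mul_right_cancel₀ hn'
    linear_combination -h2
  rw [e2] at h3 h4
  have e3 : PowerSeries.coeff 3 L = -(((n : ℚ) - 1) / 2) + 11 / 6 * (((n : ℚ) ^ 2 - 1) / 12) +
      (-((n : ℚ) ^ 4 - 1) / 120) / 6 := by
    apply mul_right_cancel₀ hn'
    linear_combination -h3
  rw [e3] at h4
  have e4 : PowerSeries.coeff 4 L = ((n : ℚ) - 1) / 2 - 25 / 12 * (((n : ℚ) ^ 2 - 1) / 12) -
      5 / 12 * (-((n : ℚ) ^ 4 - 1) / 120) := by
    apply mul_right_cancel₀ hn'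
    linear_combination -h4
  interval_cases k <;> simp only [cumulantCoeff, e0, e1, e2, e3, e4]

theorem logDerivative_cyclotomic {n : ℕ} (hn : 2 ≤ n) :
    PowerSeries.logDerivative (expansionAtOne (cyclotomic n ℚ)) =
      ∑ d ∈ n.divisors, ArithmeticFunction.moebius (n / d) •
        PowerSeries.logDerivative (expansionAtOne (∑ i ∈ range d, (X : ℚ[X]) ^ i)) := by
  let f : ℕ → PowerSeries ℚ := fun m =>
    if m = 1 then 0 else PowerSeries.logDerivative (expansionAtOne (cyclotomic m ℚ))
  have hsum : ∀ m > 0, ∑ d ∈ m.divisors, f d =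
      PowerSeries.logDerivative (expansionAtOne (∑ i ∈ range m, (X : ℚ[X]) ^ i)) := by
    intro m hm
    rw [← prod_cyclotomic_eq_geom_sum hm, expansionAtOne_prod, PowerSeries.logDerivative_prod]
    · rw [← sum_erase m.divisors (show f 1 = 0 from if_pos rfl)]
      exact sum_congr rfl fun d hd => if_neg (ne_of_mem_erase hd)
    · intro d hd
      rw [constantCoeff_expansionAtOne]
      have := Nat.pos_of_mem_divisors (mem_of_mem_erase hd)
      have := ne_of_mem_erase hd
      exact eval_one_cyclotomic_ne_zero (by omega)
  have h := ArithmeticFunction.sum_eq_iff_sum_smul_moebius_eq.1 hsum n (by omega)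
  rw [Nat.sum_divisorsAntidiagonal' (fun a b => ArithmeticFunction.moebius a •
    PowerSeries.logDerivative (expansionAtOne (∑ i ∈ range b, (X : ℚ[X]) ^ i)))] at h
  rw [h]
  exact (if_neg (by omega)).symm

theorem jordanTotient_one {n : ℕ} (hn : 0 < n) : jordanTotient 1 n = n.totient := by
  have h := (ArithmeticFunction.sum_eq_iff_sum_mul_moebius_eq (R := ℤ)
    (f := fun m => (m.totient : ℤ)) (g := fun m => (m : ℤ))).1
    (fun m _ => by exact_mod_cast Nat.sum_totient m) n hn
  simp only [Int.cast_id] at h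
  rw [Nat.sum_divisorsAntidiagonal'
    (fun a b => ArithmeticFunction.moebius a * (b : ℤ))] at h
  simpa [jordanTotient] using h

theorem jordanTotient_zero {n : ℕ} (hn : 2 ≤ n) : jordanTotient 0 n = 0 := by
  have h := (ArithmeticFunction.sum_eq_iff_sum_mul_moebius_eq (R := ℤ)
    (f := fun m => if m = 1 then 1 else 0) (g := fun _ => 1)).1
    (fun m hm => by simp [hm.ne']) n (by omega)
  simp only [Int.cast_id] at h
  rw [Nat.sum_divisorsAntidiagonal'
    (fun a _ => ArithmeticFunction.moebius a * (1 : ℤ))] at h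
  simpa [jordanTotient, show n ≠ 1 by omega] using h

theorem coeff_logDerivative_cyclotomic {n : ℕ} (hn : 2 ≤ n) {k : ℕ} (hk : k < 5) :
    PowerSeries.coeff k (PowerSeries.logDerivative (expansionAtOne (cyclotomic n ℚ))) =
      cumulantCoeff ((n.totient : ℚ) / 2) ((jordanTotient 2 n : ℚ) / 12)
        (-(jordanTotient 4 n : ℚ) / 120) k := by
  have hJ (j : ℕ) : (jordanTotient j n : ℚ) =
      ∑ d ∈ n.divisors, (ArithmeticFunction.moebius (n / d) : ℚ) * (d : ℚ) ^ j := by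
    simp [jordanTotient]
  have h0 : ∑ d ∈ n.divisors, (ArithmeticFunction.moebius (n / d) : ℚ) = 0 := by
    simpa [jordanTotient_zero hn] using (hJ 0).symm
  have hsub (j : ℕ) : ∑ d ∈ n.divisors,
      (ArithmeticFunction.moebius (n / d) : ℚ) * ((d : ℚ) ^ j - 1) = jordanTotient j n := by
    simp only [mul_sub, mul_one, sum_sub_distrib, h0, sub_zero, hJ]
  have hlin (a b c : ℚ) : ∑ d ∈ n.divisors, (ArithmeticFunction.moebius (n / d) : ℚ) *
      (a * ((d : ℚ) ^ 1 - 1) + b * ((d : ℚ) ^ 2 - 1) + c * ((d : ℚ) ^ 4 - 1)) =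
      a * n.totient + b * jordanTotient 2 n + c * jordanTotient 4 n := by
    have hT : (n.totient : ℚ) = jordanTotient 1 n := by
      rw [jordanTotient_one (by omega)]; norm_cast
    rw [hT, ← hsub 1, ← hsub 2, ← hsub 4, mul_sum, mul_sum, mul_sum, ← sum_add_distrib,
      ← sum_add_distrib]
    exact sum_congr rfl fun d _ => by ring
  rw [logDerivative_cyclotomic hn, map_sum]
  have hterm : ∀ d ∈ n.divisors, PowerSeries.coeff k (ArithmeticFunction.moebius (n / d) •
      PowerSeries.logDerivative (expansionAtOne (∑ i ∈ range d, (X : ℚ[X]) ^ i))) =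
      (ArithmeticFunction.moebius (n / d) : ℚ) * cumulantCoeff (((d : ℚ) - 1) / 2)
        (((d : ℚ) ^ 2 - 1) / 12) (-((d : ℚ) ^ 4 - 1) / 120) k := fun d hd => by
    rw [map_zsmul, coeff_logDerivative_geom_sum (Nat.pos_of_mem_divisors hd) hk, zsmul_eq_mul]
  rw [sum_congr rfl hterm]
  obtain ⟨a, b, c, habc⟩ : ∃ a b c : ℚ, ∀ x y z : ℚ,
      cumulantCoeff (x / 2) (y / 12) (-z / 120) k = a * x + b * y + c * z := by
    interval_cases k
    · exact ⟨1 / 2, 0, 0, fun x y z => by simp only [cumulantCoeff]; ring⟩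
    · exact ⟨-1 / 2, 1 / 12, 0, fun x y z => by simp only [cumulantCoeff]; ring⟩
    · exact ⟨1 / 2, -1 / 8, 0, fun x y z => by simp only [cumulantCoeff]; ring⟩
    · exact ⟨-1 / 2, 11 / 72, -1 / 720, fun x y z => by simp only [cumulantCoeff]; ring⟩
    · exact ⟨1 / 2, -25 / 144, 1 / 288, fun x y z => by simp only [cumulantCoeff]; ring⟩
  simp only [habc]
  simpa using hlin a b c

theorem cyclotomic_fifth_deriv_one (n : ℕ) (hn : 2 ≤ n) :
    96 * (Polynomial.derivative^[5] (Polynomial.cyclotomic n ℤ)).eval 1 =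
      (Polynomial.cyclotomic n ℤ).eval 1 * ((Nat.totient n : ℤ) - 4) *
        (3 * (Nat.totient n : ℤ) ^ 4 - 48 * (Nat.totient n : ℤ) ^ 3
          + 10 * jordanTotient 2 n * (Nat.totient n : ℤ) ^ 2
          + 228 * (Nat.totient n : ℤ) ^ 2
          - 80 * jordanTotient 2 n * (Nat.totient n : ℤ)
          - 288 * (Nat.totient n : ℤ)
          + 5 * jordanTotient 2 n ^ 2 + 100 * jordanTotient 2 n
          - 2 * jordanTotient 4 n) := by
  have hf0 : PowerSeries.constantCoeff (expansionAtOne (cyclotomic n ℚ)) ≠ 0 := by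
    rw [constantCoeff_expansionAtOne]
    exact eval_one_cyclotomic_ne_zero hn
  have hrec := PowerSeries.coeff_succ_mul_eq_sum_logDerivative hf0
  have h0 := hrec 0
  have h1 := hrec 1
  have h2 := hrec 2
  have h3 := hrec 3
  have h4 := hrec 4
  simp only [sum_range_succ, range_zero, sum_empty,
    coeff_logDerivative_cyclotomic hn (show 0 < 5 by norm_num),
    coeff_logDerivative_cyclotomic hn (show 1 < 5 by norm_num),
    coeff_logDerivative_cyclotomic hn (show 2 < 5 by norm_num),
    coeff_logDerivative_cyclotomic hn (show 3 < 5 by norm_num),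
    coeff_logDerivative_cyclotomic hn (show 4 < 5 by norm_num), cumulantCoeff] at h0 h1 h2 h3 h4
  norm_num [-PowerSeries.coeff_zero_eq_constantCoeff] at h0 h1 h2 h3 h4
  have hcast (k : ℕ) : (((derivative^[k] (cyclotomic n ℤ)).eval 1 : ℤ) : ℚ) =
      k.factorial * PowerSeries.coeff k (expansionAtOne (cyclotomic n ℚ)) := by
    rw [factorial_mul_coeff_expansionAtOne, ← map_cyclotomic_int n ℚ, iterate_derivative_map,
      eval_one_map, eq_intCast]
  have hcast0 := hcast 0
  have hcast5 := hcast 5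
  norm_num [Nat.factorial, -PowerSeries.coeff_zero_eq_constantCoeff, -Function.iterate_succ]
    at hcast0 hcast5
  rw [← @Int.cast_inj ℚ]
  push_cast
  rw [hcast0, hcast5]
  generalize (n.totient : ℚ) = t at *
  generalize (jordanTotient 2 n : ℚ) = u at *
  generalize (jordanTotient 4 n : ℚ) = v at *
  generalize PowerSeries.coeff 5 (expansionAtOne (cyclotomic n ℚ)) = f5 at *
  generalize PowerSeries.coeff 4 (expansionAtOne (cyclotomic n ℚ)) = f4 at *
  generalize PowerSeries.coeff 3 (expansionAtOne (cyclotomic n ℚ)) = f3 at *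
  generalize PowerSeries.coeff 2 (expansionAtOne (cyclotomic n ℚ)) = f2 at *
  generalize PowerSeries.coeff 1 (expansionAtOne (cyclotomic n ℚ)) = f1 at *
  generalize PowerSeries.coeff 0 (expansionAtOne (cyclotomic n ℚ)) = f0 at *
  have e2 := eq_div_of_mul_eq two_ne_zero h1
  have e3 := eq_div_of_mul_eq three_ne_zero h2
  have e4 := eq_div_of_mul_eq four_ne_zero h3
  have e5 := eq_div_of_mul_eq (by norm_num : (5 : ℚ) ≠ 0) h4
  rw [e5, e4, e3, e2, h0]
  ring
end

section
/- Let k ≥ 3 and n ≥ k + 2 be integers. Then for every prime p and every integer e ≥ 1 such that λ(p^e) divides k but λ(p^{e+1}) does not divide k, the prime power p^e divides J_k(n). (Equivalently, J_k(n) ≡ 0 modulo the product ∏ p^e taken over all prime powers p^e with λ(p^e) ∥ k.) -/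
open Polynomial Finset

/-- Carmichael lambda function: the exponent of the unit group of `ℤ/mℤ`. -/
noncomputable def carmichael (m : ℕ) : ℕ := Monoid.exponent (ZMod m)ˣ

theorem jordanTotient_eq_moebius_mul_pow {k : ℕ} (hk : k ≠ 0) (n : ℕ) :
    jordanTotient k n =
      (ArithmeticFunction.moebius * (ArithmeticFunction.pow k : ArithmeticFunction ℤ)) n := by
  rw [ArithmeticFunction.mul_apply, Nat.sum_divisorsAntidiagonal'
    fun x y ↦ ArithmeticFunction.moebius x * (ArithmeticFunction.pow k : ArithmeticFunction ℤ) y]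
  simp [jordanTotient, ArithmeticFunction.pow_apply, hk]

theorem jordanTotient_mul_of_coprime {k m n : ℕ} (hk : k ≠ 0) (h : m.Coprime n) :
    jordanTotient k (m * n) = jordanTotient k m * jordanTotient k n := by
  simp only [jordanTotient_eq_moebius_mul_pow hk]
  exact (ArithmeticFunction.isMultiplicative_moebius.mul
    ArithmeticFunction.isMultiplicative_pow.natCast).map_mul_of_coprime h

theorem sum_divisors_jordanTotient {k n : ℕ} (hk : k ≠ 0) :
    ∑ d ∈ n.divisors, jordanTotient k d = (n : ℤ) ^ k := by
  simp only [jordanTotient_eq_moebius_mul_pow hk]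
  rw [← ArithmeticFunction.coe_zeta_mul_apply, ← mul_assoc,
    ArithmeticFunction.coe_zeta_mul_moebius, one_mul]
  simp [ArithmeticFunction.pow_apply, hk]

theorem jordanTotient_prime_pow_succ {k q : ℕ} (hk : k ≠ 0) (hq : q.Prime) (b : ℕ) :
    jordanTotient k (q ^ (b + 1)) = ((q : ℤ) ^ b) ^ k * ((q : ℤ) ^ k - 1) := by
  have h₁ := sum_divisors_jordanTotient (n := q ^ (b + 1)) hk
  have h₀ := sum_divisors_jordanTotient (n := q ^ b) hk
  rw [Nat.sum_divisors_prime_pow hq] at h₀ h₁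
  rw [sum_range_succ, h₀] at h₁
  push_cast at h₁
  linear_combination h₁

theorem dvd_pow_sub_one_of_carmichael_dvd {m k a : ℕ} (h : carmichael m ∣ k)
    (ha : a.Coprime m) : (m : ℤ) ∣ (a : ℤ) ^ k - 1 := by
  have hu : ZMod.unitOfCoprime a ha ^ k = 1 := Monoid.exponent_dvd_iff_forall_pow_eq_one.mp h _
  have hz : (a : ZMod m) ^ k = 1 := by
    simpa using congrArg Units.val hu
  rw [← ZMod.intCast_zmod_eq_zero_iff_dvd]
  simp [hz]

theorem carmichael_eq_arithmeticFunction {m : ℕ} (hm : m ≠ 0) :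
    carmichael m = ArithmeticFunction.carmichael m :=
  (ArithmeticFunction.carmichael_eq_exponent hm).symm

theorem le_of_carmichael_prime_pow_dvd {k p e : ℕ} (hk : 3 ≤ k) (hp : p.Prime)
    (h : carmichael (p ^ e) ∣ k) : e ≤ k := by
  rw [carmichael_eq_arithmeticFunction (pow_ne_zero _ hp.ne_zero)] at h
  rcases eq_or_ne p 2 with rfl | hp₂
  · by_cases he : e = 2
    · omega
    rw [ArithmeticFunction.carmichael_two_pow_of_ne_two he] at h
    by_contra! hlt
    have hle := Nat.le_of_dvd (by omega) h
    have hmono : 2 ^ (k - 1) ≤ 2 ^ (e - 2) := Nat.pow_le_pow_right (by norm_num) (by omega)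
    have hlt' := Nat.lt_two_pow_self (n := k - 2)
    have hpow : 2 ^ (k - 1) = 2 * 2 ^ (k - 2) := by
      rw [← pow_succ', show k - 2 + 1 = k - 1 by omega]
    omega
  · rcases Nat.eq_zero_or_pos e with rfl | he
    · omega
    rw [ArithmeticFunction.carmichael_pow_of_prime_ne_two _ hp hp₂,
      Nat.totient_prime_pow hp he] at h
    have hle := Nat.le_of_dvd (by omega) (dvd_of_mul_right_dvd h)
    have hlt := Nat.lt_pow_self hp.one_lt (n := e - 1)
    omega

theorem carmichael_prime {p : ℕ} (hp : p.Prime) : carmichael p = p - 1 := by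
  rw [carmichael_eq_arithmeticFunction hp.ne_zero, ← pow_one p]
  rcases eq_or_ne p 2 with rfl | hp₂
  · rw [ArithmeticFunction.carmichael_two_pow_of_le_two one_le_two]
    norm_num
  · rw [ArithmeticFunction.carmichael_pow_of_prime_ne_two _ hp hp₂, pow_one, Nat.totient_prime hp]

theorem le_add_one_of_carmichael_prime_pow_dvd {k p e : ℕ} (hk : k ≠ 0) (hp : p.Prime)
    (he : e ≠ 0) (h : carmichael (p ^ e) ∣ k) : p ≤ k + 1 := by
  have hdvd : carmichael p ∣ carmichael (p ^ e) := by
    rw [carmichael_eq_arithmeticFunction hp.ne_zero,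
      carmichael_eq_arithmeticFunction (pow_ne_zero _ hp.ne_zero)]
    exact ArithmeticFunction.carmichael_dvd (dvd_pow_self p he)
  have hle := Nat.le_of_dvd (Nat.pos_of_ne_zero hk) (hdvd.trans h)
  rw [carmichael_prime hp] at hle
  omega

theorem jordanTotient_trivial_congruence (k n : ℕ) (hk : 3 ≤ k) (hn : k + 2 ≤ n)
    (p : ℕ) (hp : p.Prime) (e : ℕ) (he : 1 ≤ e)
    (hdvd : carmichael (p ^ e) ∣ k) (hndvd : ¬ carmichael (p ^ (e + 1)) ∣ k) :
    ((p : ℤ) ^ e) ∣ jordanTotient k n := by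
  have hk₀ : k ≠ 0 := by omega
  by_cases hq : ∃ q, q.Prime ∧ q ∣ n ∧ q ≠ p
  · obtain ⟨q, hq, hqn, hqp⟩ := hq
    obtain ⟨b, m, hqm, rfl⟩ := Nat.exists_eq_pow_mul_and_not_dvd (by omega : n ≠ 0) q hq.ne_one
    obtain _ | b := b
    · simp [hqm] at hqn
    have hcop : (q ^ (b + 1)).Coprime m := (hq.coprime_iff_not_dvd.mpr hqm).pow_left _
    rw [jordanTotient_mul_of_coprime hk₀ hcop, jordanTotient_prime_pow_succ hk₀ hq]
    have hqpe : q.Coprime (p ^ e) := ((Nat.coprime_primes hq hp).mpr hqp).pow_right _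
    have := dvd_pow_sub_one_of_carmichael_dvd hdvd hqpe
    push_cast at this
    exact (this.mul_left _).mul_right _
  · push Not at hq
    obtain ⟨b, rfl⟩ : ∃ b, n = p ^ b :=
      ⟨_, Nat.eq_prime_pow_of_unique_prime_dvd (by omega) (fun {d} hd hdn ↦ hq d hd hdn)⟩
    obtain _ | _ | b := b
    · simp at hn
    · have := le_add_one_of_carmichael_prime_pow_dvd hk₀ hp (by omega) hdvd
      simp at hn
      omega
    · rw [jordanTotient_prime_pow_succ hk₀ hp, ← pow_mul]
      have hek := le_of_carmichael_prime_pow_dvd hk hp hdvd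
      exact (pow_dvd_pow _ (hek.trans (Nat.le_mul_of_pos_left k b.succ_pos))).mul_right _
end

section
/- For every positive integer n, the integer φ(n) − 2 divides 2·Φ_n'''(1). Moreover, if φ(n) is divisible by 4, then φ(n) − 2 divides Φ_n'''(1). -/
open Polynomial

/-- Cyclotomic polynomials other than the first are self-reciprocal. -/
theorem reverse_cyclotomic_of_one_lt {n : ℕ} (hn : 1 < n) :
    (cyclotomic n ℤ).reverse = cyclotomic n ℤ := by
  have hζ := Complex.isPrimitiveRoot_exp n (by lia)
  set ζ := Complex.exp (2 * Real.pi * Complex.I / n)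
  have hcoeff : (cyclotomic n ℤ).coeff 0 = 1 := cyclotomic_coeff_zero ℤ hn
  have htrail : (cyclotomic n ℤ).natTrailingDegree = 0 :=
    natTrailingDegree_eq_zero.2 (Or.inr (by simp [hcoeff]))
  have hmonic : (cyclotomic n ℤ).reverse.Monic := by
    rw [Monic, reverse_leadingCoeff, trailingCoeff, htrail, hcoeff]
  have hroot : eval₂ (algebraMap ℤ ℂ) ζ⁻¹ (cyclotomic n ℤ) = 0 := by
    have h := hζ.inv.isRoot_cyclotomic (by lia)
    rwa [← map_cyclotomic_int, IsRoot.def, eval_map] at h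
  have hdvd : cyclotomic n ℤ ∣ (cyclotomic n ℤ).reverse := by
    conv_lhs => rw [cyclotomic_eq_minpoly hζ (by lia)]
    refine minpoly.isIntegrallyClosed_dvd (hζ.isIntegral (by lia)) ?_
    let : Invertible ζ⁻¹ := invertibleOfNonzero (inv_ne_zero (hζ.ne_zero (by lia)))
    have h := (eval₂_reverse_eq_zero_iff (algebraMap ℤ ℂ) ζ⁻¹ (cyclotomic n ℤ)).2 hroot
    rwa [invOf_eq_inv, inv_inv] at h
  exact (eq_of_monic_of_dvd_of_natDegree_le (cyclotomic.monic n ℤ) hmonic hdvd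
    (reverse_natDegree_le _))

theorem Polynomial.eval_one_iterate_derivative_three (p : ℤ[X]) :
    (derivative^[3] p).eval 1 =
      ∑ k ∈ Finset.range (p.natDegree + 1), p.coeff k * ((k : ℤ) * (k - 1) * (k - 2)) := by
  conv_lhs => rw [p.as_sum_range_C_mul_X_pow]
  simp only [iterate_derivative_sum, iterate_derivative_C_mul, eval_finsetSum, eval_mul, eval_C,
    iterate_derivative_X_pow_eq_natCast_mul, eval_natCast, eval_pow, eval_X, one_pow, mul_one]
  refine Finset.sum_congr rfl fun k _ ↦ ?_
  rcases k with _ | _ | k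
  · simp
  · simp
  · simp only [Nat.descFactorial, Nat.cast_mul]
    push_cast [show k + 1 + 1 - 2 = k by lia, show k + 1 + 1 - 1 = k + 1 by lia, Nat.sub_zero]
    ring

/-- The coefficients of a self-reciprocal polynomial of degree `2 * h` are symmetric about `h`. -/
theorem Polynomial.sum_coeff_mul_neg_of_reverse_eq {p : ℤ[X]} {h : ℕ}
    (hdeg : p.natDegree = 2 * h) (hrev : p.reverse = p) (f : ℤ → ℤ) :
    ∑ k ∈ Finset.range (p.natDegree + 1), p.coeff k * f (-(k - h)) =
      ∑ k ∈ Finset.range (p.natDegree + 1), p.coeff k * f (k - h) := by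
  rw [← Finset.sum_flip]
  refine Finset.sum_congr rfl fun k hk ↦ ?_
  have hk : k ≤ p.natDegree := by simpa [Nat.lt_succ_iff] using hk
  have hcoeff : p.coeff (p.natDegree - k) = p.coeff k := by
    conv_rhs => rw [← hrev, coeff_reverse, revAt_le hk]
  rw [hcoeff, Nat.cast_sub hk, hdeg]
  congr 2
  push_cast
  ring

/-- The third derivative at `1` of a self-reciprocal polynomial of even degree. -/
theorem Polynomial.exists_eval_one_iterate_derivative_three_eq {p : ℤ[X]} {h : ℕ}
    (hdeg : p.natDegree = 2 * h) (hrev : p.reverse = p) :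
    ∃ c : ℤ, (derivative^[3] p).eval 1 = (h - 1) * (h * (h - 2) * p.eval 1 + 6 * c) := by
  have hodd (f : ℤ → ℤ) (hf : ∀ u, f (-u) = -f u) :
      ∑ k ∈ Finset.range (p.natDegree + 1), p.coeff k * f (k - h) = 0 := by
    have := sum_coeff_mul_neg_of_reverse_eq hdeg hrev f
    simp only [hf, mul_neg, Finset.sum_neg_distrib] at this
    lia
  have hS := hodd (fun u ↦ u ^ 3 + (3 * h ^ 2 - 3 * h - 1) * u) fun u ↦ by ring
  have hparity (u : ℤ) : ∃ v, u * (u - 1) = 2 * v :=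
    (Int.even_mul_pred_self u).two_dvd
  choose v hv using hparity
  refine ⟨∑ k ∈ Finset.range (p.natDegree + 1), p.coeff k * v (k - h), ?_⟩
  rw [eval_one_iterate_derivative_three, eval_eq_sum_range]
  have key : ∀ k : ℕ, p.coeff k * ((k : ℤ) * (k - 1) * (k - 2)) =
      (h - 1) * (h * (h - 2) * (p.coeff k * 1 ^ k) + 6 * (p.coeff k * v (k - h))) +
        p.coeff k * ((k - h : ℤ) ^ 3 + (3 * h ^ 2 - 3 * h - 1) * (k - h : ℤ)) := fun k ↦ by
    rw [one_pow]
    linear_combination 3 * (h - 1) * p.coeff k * hv (k - h)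
  rw [Finset.sum_congr rfl fun k _ ↦ key k]
  simp only [Finset.sum_add_distrib, ← Finset.mul_sum, hS, add_zero]

theorem cyclotomic_third_deriv_one_dvd (n : ℕ) (hn : 0 < n) :
    ((Nat.totient n : ℤ) - 2) ∣ 2 * (Polynomial.derivative^[3] (Polynomial.cyclotomic n ℤ)).eval 1 ∧
      (4 ∣ Nat.totient n →
        ((Nat.totient n : ℤ) - 2) ∣ (Polynomial.derivative^[3] (Polynomial.cyclotomic n ℤ)).eval 1) := by
  obtain hn2 | hn2 := le_or_gt n 2
  · interval_cases n <;> simp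
  obtain ⟨h, hh⟩ := (Nat.totient_even hn2).two_dvd
  obtain ⟨c, hc⟩ := exists_eval_one_iterate_derivative_three_eq
    ((natDegree_cyclotomic n ℤ).trans hh) (reverse_cyclotomic_of_one_lt (by lia))
  rw [hc, hh]
  push_cast
  refine ⟨⟨h * (h - 2) * (cyclotomic n ℤ).eval 1 + 6 * c, by ring⟩, fun h4 ↦ ?_⟩
  obtain ⟨j, rfl⟩ : 2 ∣ h := by lia
  refine ⟨j * (2 * j - 2) * (cyclotomic n ℤ).eval 1 + 3 * c, ?_⟩
  push_cast
  ring
end
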